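/- (Condorcet-Smith principle) Let v be a complete Llull matrix on a finite set A, and suppose A is partitioned into two disjoint nonempty sets X and Y such that v_{xy} > 1/2 for every x ∈ X and y ∈ Y. Then for every x ∈ X and y ∈ Y one has v*_{xy} > v*_{yx} (i.e. (x,y) belongs to the indirect comparison relation ν) and R_x < R_y, where R denotes the rank-like rates. -/

import Mathlib

/-! Common definitions: valued relations, indirect scores, admissible orders,
projected margins/scores, rank-like rates (Camps–Mora–Saumell CLC method). -/

variable {A : Type*} [Fintype A] [DecidableEq A]

/-- The score of a chain `x₀ :: x₁ :: ... :: xₙ`: the minimum of `v xᵢ xᵢ₊₁`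
over its links (value `1` for chains with no link, which we never use). -/
noncomputable def linkScore (v : A → A → ℝ) : List A → ℝ
  | [] => 1
  | [_] => 1
  | [a, b] => v a b
  | a :: b :: c :: l => min (v a b) (linkScore v (b :: c :: l))

/-- The indirect score `v*_{xy}`: the supremum (= maximum) of the scores of all
paths from `x` to `y` (with at least one link, consecutive elements distinct). -/
noncomputable def istar (v : A → A → ℝ) (x y : A) : ℝ :=
  sSup { s : ℝ | ∃ l : List A, List.Chain' (· ≠ ·) (x :: (l ++ [y])) ∧
      s = linkScore v (x :: (l ++ [y])) }

/-- `ξ` is a strict total order: irreflexive, transitive, total. -/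
def StrictTotal (ξ : A → A → Prop) : Prop :=
  (∀ x, ¬ ξ x x) ∧ (∀ x y z, ξ x y → ξ y z → ξ x z) ∧ (∀ x y, x ≠ y → ξ x y ∨ ξ y x)

/-- `ξ` is admissible for `v`: `v*_{xy} > v*_{yx}` implies `x` precedes `y`. -/
def Adm (v : A → A → ℝ) (ξ : A → A → Prop) : Prop :=
  ∀ x y, istar v x y > istar v y x → ξ x y

/-- Intermediate projected margin `m^σ_{xy}` (for `x` preceding `y` in `ξ`):
the infimum (= minimum) of the indirect margins `m*_{pq}` over `p ⪯ x`, `y ⪯ q`. -/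
noncomputable def msigma (v : A → A → ℝ) (ξ : A → A → Prop) (x y : A) : ℝ :=
  sInf { s : ℝ | ∃ p q, (ξ p x ∨ p = x) ∧ (ξ y q ∨ q = y) ∧
      s = istar v p q - istar v q p }

/-- `q` is the immediate successor of `p` in `ξ`. -/
def ImmSucc (ξ : A → A → Prop) (p q : A) : Prop :=
  ξ p q ∧ ∀ z, ¬ (ξ p z ∧ ξ z q)

/-- Projected margin (for `x` preceding `y` in `ξ`): the supremum (= maximum) of
`m^σ_{p p'}` over `x ⪯ p ≺ y`, `p'` the immediate successor of `p`. -/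
noncomputable def mpiAux (v : A → A → ℝ) (ξ : A → A → Prop) (x y : A) : ℝ :=
  sSup { s : ℝ | ∃ p q, (ξ x p ∨ p = x) ∧ ξ p y ∧ ImmSucc ξ p q ∧
      s = msigma v ξ p q }

open Classical in
/-- Projected margins `m^π`, extended antisymmetrically. -/
noncomputable def mpi (v : A → A → ℝ) (ξ : A → A → Prop) (x y : A) : ℝ :=
  if ξ x y then mpiAux v ξ x y else - mpiAux v ξ y x

/-- Projected scores `v^π_{xy} = (1 + m^π_{xy})/2`. -/
noncomputable def vpi (v : A → A → ℝ) (ξ : A → A → Prop) (x y : A) : ℝ :=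
  (1 + mpi v ξ x y) / 2

/-- Rank-like rate `R_x = N - ∑_{y ≠ x} v^π_{xy}`. -/
noncomputable def rlr (v : A → A → ℝ) (ξ : A → A → Prop) (x : A) : ℝ :=
  (Fintype.card A : ℝ) - ∑ y ∈ Finset.univ.erase x, vpi v ξ x y

/-- `v` is a complete Llull matrix: scores of distinct pairs lie in `[0,1]`
and satisfy `v_{xy} + v_{yx} = 1`. -/
def Llull (v : A → A → ℝ) : Prop :=
  ∀ x y : A, x ≠ y → 0 ≤ v x y ∧ v x y ≤ 1 ∧ v x y + v y x = 1

omit [Fintype A] [DecidableEq A] in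
theorem linkScore_cons_cons_append (v : A → A → ℝ) (a b y : A) (l : List A) :
    linkScore v (a :: b :: (l ++ [y])) = min (v a b) (linkScore v (b :: (l ++ [y]))) := by
  cases l <;> rfl

omit [Fintype A] [DecidableEq A] in
theorem linkScore_le_one {v : A → A → ℝ} (hv : Llull v) (a y : A) (l : List A)
    (h : List.IsChain (· ≠ ·) (a :: (l ++ [y]))) : linkScore v (a :: (l ++ [y])) ≤ 1 := by
  cases l with
  | nil =>
    have hay : a ≠ y := by simpa using h
    exact (hv a y hay).2.1
  | cons b l =>
    rw [List.cons_append, linkScore_cons_cons_append]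
    have hab : a ≠ b := (List.isChain_cons_cons.1 h).1
    exact (min_le_left _ _).trans (hv a b hab).2.1

omit [Fintype A] [DecidableEq A] in
theorem linkScore_le_of_crossing {v : A → A → ℝ} {S : Set A} {c : ℝ}
    (hc : ∀ a ∉ S, ∀ b ∈ S, v a b ≤ c) {x : A} (hx : x ∈ S) (l : List A) :
    ∀ a ∉ S, linkScore v (a :: (l ++ [x])) ≤ c := by
  induction l with
  | nil => exact fun a ha => hc a ha x hx
  | cons b l ih =>
    intro a ha
    rw [List.cons_append, linkScore_cons_cons_append]
    by_cases hb : b ∈ S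
    · exact (min_le_left _ _).trans (hc a ha b hb)
    · exact (min_le_right _ _).trans (ih b hb)

omit [Fintype A] [DecidableEq A] in
theorem le_istar {v : A → A → ℝ} (hv : Llull v) {x y : A} (hxy : x ≠ y) :
    v x y ≤ istar v x y := by
  refine le_csSup ⟨1, ?_⟩ ⟨[], List.isChain_pair.2 hxy, rfl⟩
  rintro s ⟨l, hl, rfl⟩
  exact linkScore_le_one hv x y l hl

omit [Fintype A] [DecidableEq A] in
theorem istar_le_of_crossing {v : A → A → ℝ} {S : Set A} {c : ℝ}
    (hc : ∀ a ∉ S, ∀ b ∈ S, v a b ≤ c) {x y : A} (hx : x ∈ S) (hy : y ∉ S) :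
    istar v y x ≤ c := by
  have hyx : y ≠ x := fun h => hy (h ▸ hx)
  refine csSup_le ⟨_, [], List.isChain_pair.2 hyx, rfl⟩ ?_
  rintro s ⟨l, -, rfl⟩
  exact linkScore_le_of_crossing hc hx l y hy

omit [DecidableEq A] in
theorem istar_lt_istar_of_majority {v : A → A → ℝ} (hv : Llull v) {S : Set A}
    (hmaj : ∀ x ∈ S, ∀ y ∉ S, v x y > 1 / 2) {x y : A} (hx : x ∈ S) (hy : y ∉ S) :
    istar v y x < istar v x y := by
  obtain ⟨⟨a, b⟩, ⟨ha, hb⟩, hab⟩ :=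
    (Set.toFinite {p : A × A | p.1 ∉ S ∧ p.2 ∈ S}).exists_maximalFor (fun p => v p.1 p.2) _
      ⟨(y, x), hy, hx⟩
  have hle : istar v y x ≤ v a b := by
    refine istar_le_of_crossing (fun p hp q hq => ?_) hx hy
    rcases le_total (v p q) (v a b) with h | h
    · exact h
    · exact hab (j := (p, q)) ⟨hp, hq⟩ h
  have hba : b ≠ a := fun h => ha (h ▸ hb)
  have hxy : x ≠ y := fun h => hy (h ▸ hx)
  have h₁ := hmaj b hb a ha
  have h₂ := (hv b a hba).2.2
  have h₃ := hmaj x hx y hy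
  have h₄ := le_istar hv hxy
  linarith

omit [DecidableEq A] in
theorem StrictTotal.exists_first {ξ : A → A → Prop} (hξ : StrictTotal ξ) {S : Set A}
    (hS : S.Nonempty) : ∃ a ∈ S, ∀ b ∈ S, ¬ ξ b a := by
  have : Std.Irrefl ξ := ⟨hξ.1⟩
  have : IsTrans A ξ := ⟨hξ.2.1⟩
  exact (Finite.wellFounded_of_trans_of_irrefl ξ).has_min S hS

omit [Fintype A] [DecidableEq A] in
theorem StrictTotal.swap {ξ : A → A → Prop} (hξ : StrictTotal ξ) :
    StrictTotal (fun x y => ξ y x) :=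
  ⟨hξ.1, fun x y z hxy hyz => hξ.2.1 z y x hyz hxy, fun x y h => (hξ.2.2 x y h).symm⟩

omit [Fintype A] [DecidableEq A] in
theorem StrictTotal.asymm {ξ : A → A → Prop} (hξ : StrictTotal ξ) {x y : A} (h : ξ x y) :
    ¬ ξ y x :=
  fun h' => hξ.1 x (hξ.2.1 x y x h h')

omit [DecidableEq A] in
theorem StrictTotal.exists_immSucc {ξ : A → A → Prop} (hξ : StrictTotal ξ) {x y : A}
    (h : ξ x y) : ∃ q, ImmSucc ξ x q := by
  obtain ⟨q, hxq, hq⟩ := hξ.exists_first (S := {z | ξ x z}) ⟨y, h⟩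
  exact ⟨q, hxq, fun z hz => hq z hz.1 hz.2⟩

omit [DecidableEq A] in
theorem msigma_mem (v : A → A → ℝ) (ξ : A → A → Prop) (x y : A) :
    ∃ p q, (ξ p x ∨ p = x) ∧ (ξ y q ∨ q = y) ∧ msigma v ξ x y = istar v p q - istar v q p := by
  refine Set.Nonempty.csInf_mem (s := {s : ℝ | ∃ p q, (ξ p x ∨ p = x) ∧ (ξ y q ∨ q = y) ∧
    s = istar v p q - istar v q p}) ⟨_, x, y, Or.inr rfl, Or.inr rfl, rfl⟩ ?_
  refine (Set.finite_range fun p : A × A => istar v p.1 p.2 - istar v p.2 p.1).subset ?_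
  rintro s ⟨p, q, -, -, rfl⟩
  exact ⟨(p, q), rfl⟩

omit [DecidableEq A] in
theorem msigma_nonneg {v : A → A → ℝ} {ξ : A → A → Prop} (hξ : StrictTotal ξ) (hadm : Adm v ξ)
    {x y : A} (h : ξ x y) : 0 ≤ msigma v ξ x y := by
  obtain ⟨p, q, hp, hq, e⟩ := msigma_mem v ξ x y
  have hpy : ξ p y := by
    rcases hp with hp | rfl
    exacts [hξ.2.1 _ _ _ hp h, h]
  have hpq : ξ p q := by
    rcases hq with hq | rfl
    exacts [hξ.2.1 _ _ _ hpy hq, hpy]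
  rw [e, sub_nonneg]
  exact not_lt.1 fun hlt => hξ.asymm hpq (hadm q p hlt)

omit [DecidableEq A] in
theorem bddAbove_mpiAux (v : A → A → ℝ) (ξ : A → A → Prop) (x y : A) :
    BddAbove { s : ℝ | ∃ p q, (ξ x p ∨ p = x) ∧ ξ p y ∧ ImmSucc ξ p q ∧
      s = msigma v ξ p q } := by
  refine ((Set.finite_range fun p : A × A => msigma v ξ p.1 p.2).subset ?_).bddAbove
  rintro s ⟨p, q, -, -, -, rfl⟩
  exact ⟨(p, q), rfl⟩

omit [DecidableEq A] in
theorem mpiAux_nonneg {v : A → A → ℝ} {ξ : A → A → Prop} (hξ : StrictTotal ξ) (hadm : Adm v ξ)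
    (x y : A) : 0 ≤ mpiAux v ξ x y := by
  refine Real.sSup_nonneg ?_
  rintro s ⟨p, q, -, -, hpq, rfl⟩
  exact msigma_nonneg hξ hadm hpq.1

omit [DecidableEq A] in
theorem mpiAux_mono {v : A → A → ℝ} {ξ : A → A → Prop} (hξ : StrictTotal ξ) {x x' y y' : A}
    (hx : ξ x x' ∨ x' = x) (hy : ξ y' y ∨ y' = y) (h : ξ x' y') :
    mpiAux v ξ x' y' ≤ mpiAux v ξ x y := by
  obtain ⟨q, hq⟩ := hξ.exists_immSucc h
  refine csSup_le_csSup (bddAbove_mpiAux v ξ x y) ⟨_, x', q, Or.inr rfl, h, hq, rfl⟩ ?_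
  rintro s ⟨p, q, hp, hpy, hpq, rfl⟩
  refine ⟨p, q, ?_, ?_, hpq, rfl⟩
  · rcases hp with hp | rfl
    · rcases hx with hx | rfl
      exacts [Or.inl (hξ.2.1 _ _ _ hx hp), Or.inl hp]
    · exact hx
  · rcases hy with hy | rfl
    exacts [hξ.2.1 _ _ _ hpy hy, hpy]

omit [Fintype A] [DecidableEq A] in
theorem mpi_of_lt {v : A → A → ℝ} {ξ : A → A → Prop} {x y : A} (h : ξ x y) :
    mpi v ξ x y = mpiAux v ξ x y := if_pos h

omit [Fintype A] [DecidableEq A] in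
theorem mpi_of_gt {v : A → A → ℝ} {ξ : A → A → Prop} (hξ : StrictTotal ξ) {x y : A}
    (h : ξ y x) : mpi v ξ x y = -mpiAux v ξ y x := if_neg (hξ.asymm h)

omit [DecidableEq A] in
theorem mpi_le_mpi_of_lt {v : A → A → ℝ} {ξ : A → A → Prop} (hξ : StrictTotal ξ)
    (hadm : Adm v ξ) {x y z : A} (hxy : ξ x y) (hzx : z ≠ x) (hzy : z ≠ y) :
    mpi v ξ y z ≤ mpi v ξ x z := by
  rcases hξ.2.2 z x hzx with h | h
  · rw [mpi_of_gt hξ h, mpi_of_gt hξ (hξ.2.1 _ _ _ h hxy), neg_le_neg_iff]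
    exact mpiAux_mono hξ (Or.inr rfl) (Or.inl hxy) h
  · rw [mpi_of_lt h]
    rcases hξ.2.2 z y hzy with h' | h'
    · rw [mpi_of_gt hξ h']
      have h₁ := mpiAux_nonneg hξ hadm x z
      have h₂ := mpiAux_nonneg hξ hadm z y
      linarith
    · rw [mpi_of_lt h']
      exact mpiAux_mono hξ (Or.inl hxy) (Or.inr rfl) h'

theorem mpiAux_pos_of_cut {v : A → A → ℝ} {ξ : A → A → Prop} (hξ : StrictTotal ξ) {S : Set A}
    (hlt : ∀ x ∈ S, ∀ y ∉ S, istar v y x < istar v x y) (hS : ∀ x ∈ S, ∀ y ∉ S, ξ x y)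
    {x y : A} (hx : x ∈ S) (hy : y ∉ S) : 0 < mpiAux v ξ x y := by
  obtain ⟨a, ha, hlast⟩ := hξ.swap.exists_first ⟨x, hx⟩
  obtain ⟨b, hb, hfirst⟩ := hξ.exists_first (S := Sᶜ) ⟨y, hy⟩
  have hsucc : ImmSucc ξ a b := by
    refine ⟨hS a ha b hb, fun z ⟨haz, hzb⟩ => ?_⟩
    by_cases hz : z ∈ S
    exacts [hlast z hz haz, hfirst z hz hzb]
  have hxa : ξ x a ∨ a = x := by
    by_cases h : a = x
    exacts [Or.inr h, (hξ.2.2 x a (Ne.symm h)).imp_right fun h' => (hlast x hx h').elim]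
  have hpos : 0 < msigma v ξ a b := by
    obtain ⟨p, q, hp, hq, e⟩ := msigma_mem v ξ a b
    have hpS : p ∈ S := by
      rcases hp with hp | rfl
      · by_contra h
        exact hξ.asymm hp (hS a ha p h)
      · exact ha
    have hqS : q ∉ S := by
      rcases hq with hq | rfl
      · exact fun h => hξ.asymm hq (hS q h b hb)
      · exact hb
    rw [e]
    exact sub_pos.2 (hlt p hpS q hqS)
  exact hpos.trans_le
    (le_csSup (bddAbove_mpiAux v ξ x y) ⟨a, b, hxa, hS a ha y hy, hsucc, rfl⟩)

theorem rlr_lt_rlr {v : A → A → ℝ} {ξ : A → A → Prop} (hξ : StrictTotal ξ)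
    (hadm : Adm v ξ) {x y : A} (hxy : ξ x y) (hpos : 0 < mpiAux v ξ x y) :
    rlr v ξ x < rlr v ξ y := by
  have hne : x ≠ y := fun h => hξ.1 x (h ▸ hxy)
  have hyx : y ∈ Finset.univ.erase x := by simpa using hne.symm
  have hxy' : x ∈ Finset.univ.erase y := by simpa using hne
  unfold rlr
  rw [← Finset.add_sum_erase _ _ hyx, ← Finset.add_sum_erase _ _ hxy',
    Finset.erase_right_comm (a := y)]
  have hsum : ∑ z ∈ (Finset.univ.erase x).erase y, vpi v ξ y z ≤
      ∑ z ∈ (Finset.univ.erase x).erase y, vpi v ξ x z := by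
    refine Finset.sum_le_sum fun z hz => ?_
    simp only [Finset.mem_erase, Finset.mem_univ, and_true] at hz
    have := mpi_le_mpi_of_lt hξ hadm hxy hz.2 hz.1
    unfold vpi
    linarith
  have h₁ : vpi v ξ y x < vpi v ξ x y := by
    unfold vpi
    rw [mpi_of_lt hxy, mpi_of_gt hξ hxy]
    linarith
  linarith

/-- Condorcet–Smith principle: If `A` is partitioned into
nonempty sets `X`, `Y` with `v_{xy} > 1/2` for all `x ∈ X`, `y ∈ Y`, then
`v*_{xy} > v*_{yx}` and `R_x < R_y` for all such `x`, `y`. -/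
theorem stmt16 {A : Type*} [Fintype A] [DecidableEq A] (v : A → A → ℝ)
    (hv : Llull v) (X Y : Set A) (hX : X.Nonempty) (hY : Y.Nonempty)
    (hdisj : Disjoint X Y) (hcover : X ∪ Y = Set.univ)
    (hmaj : ∀ x ∈ X, ∀ y ∈ Y, v x y > 1 / 2)
    (ξ : A → A → Prop) (hξ : StrictTotal ξ) (hadm : Adm v ξ) :
    ∀ x ∈ X, ∀ y ∈ Y, istar v x y > istar v y x ∧ rlr v ξ x < rlr v ξ y := by
  obtain rfl : Y = Xᶜ :=
    (IsCompl.of_eq (disjoint_iff.1 hdisj) hcover).compl_eq.symm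
  have hlt : ∀ x ∈ X, ∀ y ∉ X, istar v y x < istar v x y :=
    fun x hx y hy => istar_lt_istar_of_majority hv hmaj hx hy
  have hcut : ∀ x ∈ X, ∀ y ∉ X, ξ x y := fun x hx y hy => hadm x y (hlt x hx y hy)
  exact fun x hx y hy => ⟨hlt x hx y hy,
    rlr_lt_rlr hξ hadm (hcut x hx y hy) (mpiAux_pos_of_cut hξ hlt hcut hx hy)⟩
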